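/- The pair of logics (classical logic, additive linear logic) is safe for the majority rule: let Φ be a finite set of ALL formulas (built from atoms by ¬, &, ⊕), closed under complement, containing no classical tautologies or contradictions under the classical reading (¬ read as classical negation, & as conjunction ∧, ⊕ as disjunction ∨). For every odd number n ≥ 3 of agents and every profile (J_1,…,J_n) of judgment sets over Φ, each of which is classically consistent under the classical reading and complete, the majority outcome M(J) is robustly consistent in ALL. -/

import Mathlib

namespace Stmt19

/-- Formulas of additive linear logic (ALL): atoms, linear negation, & and ⊕, no units. -/
inductive AForm : Type
  | atom  : ℕ → AForm
  | neg   : AForm → AForm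
  | awith : AForm → AForm → AForm         -- &
  | aplus : AForm → AForm → AForm         -- ⊕
  deriving DecidableEq

/-- Two-sided sequent calculus for ALL on multisets (no weakening, no contraction). -/
inductive ADeriv : Multiset AForm → Multiset AForm → Prop
  | ax (A) : ADeriv {A} {A}
  | cut {Γ Δ Γ' Δ' A} : ADeriv (A ::ₘ Γ) Δ → ADeriv Γ' (A ::ₘ Δ') →
      ADeriv (Γ + Γ') (Δ + Δ')
  | negL {Γ Δ A} : ADeriv Γ (A ::ₘ Δ) → ADeriv (AForm.neg A ::ₘ Γ) Δ
  | negR {Γ Δ A} : ADeriv (A ::ₘ Γ) Δ → ADeriv Γ (AForm.neg A ::ₘ Δ)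
  | withR {Γ Δ A B} : ADeriv Γ (A ::ₘ Δ) → ADeriv Γ (B ::ₘ Δ) →
      ADeriv Γ (AForm.awith A B ::ₘ Δ)
  | withL1 {Γ Δ A B} : ADeriv (A ::ₘ Γ) Δ → ADeriv (AForm.awith A B ::ₘ Γ) Δ
  | withL2 {Γ Δ A B} : ADeriv (B ::ₘ Γ) Δ → ADeriv (AForm.awith A B ::ₘ Γ) Δ
  | plusL {Γ Δ A B} : ADeriv (A ::ₘ Γ) Δ → ADeriv (B ::ₘ Γ) Δ →
      ADeriv (AForm.aplus A B ::ₘ Γ) Δ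
  | plusR1 {Γ Δ A B} : ADeriv Γ (A ::ₘ Δ) → ADeriv Γ (AForm.aplus A B ::ₘ Δ)
  | plusR2 {Γ Δ A B} : ADeriv Γ (B ::ₘ Δ) → ADeriv Γ (AForm.aplus A B ::ₘ Δ)

/-- ALL-inconsistency: Γ ⊢ (empty succedent) is derivable. -/
def AInconsistent (Γ : Multiset AForm) : Prop := ADeriv Γ 0

/-- Robust consistency in ALL: every submultiset is ALL-consistent. -/
def robustlyConsistent (Γ : Multiset AForm) : Prop :=
  ∀ Δ : Multiset AForm, Δ ≤ Γ → ¬ AInconsistent Δ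

/-- The complement ∼φ. -/
def AForm.compl : AForm → AForm
  | .neg ψ => ψ
  | φ      => .neg φ

def completeOn (Φ J : Finset AForm) : Prop := ∀ φ ∈ Φ, φ ∈ J ∨ φ.compl ∈ J

def complementFree (J : Finset AForm) : Prop := ∀ φ ∈ J, φ.compl ∉ J

def nsupp (n : ℕ) (J : Fin n → Finset AForm) (φ : AForm) : ℕ :=
  (Finset.univ.filter (fun i => φ ∈ J i)).card

/-- The majority rule. -/
def maj (n : ℕ) (Φ : Finset AForm) (J : Fin n → Finset AForm) : Finset AForm :=
  Φ.filter (fun φ => n < 2 * nsupp n J φ)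

/-- The classical reading of an ALL formula: ¬ as classical negation, & as ∧, ⊕ as ∨. -/
def AForm.eval (v : ℕ → Bool) : AForm → Bool
  | .atom i    => v i
  | .neg φ     => !(AForm.eval v φ)
  | .awith φ ψ => AForm.eval v φ && AForm.eval v ψ
  | .aplus φ ψ => AForm.eval v φ || AForm.eval v ψ

/-- Classical consistency under the classical reading. -/
def classicallyConsistent (S : Finset AForm) : Prop :=
  ∃ v : ℕ → Bool, ∀ φ ∈ S, φ.eval v = true

def isClassicalTautology (φ : AForm) : Prop := ∀ v, φ.eval v = true
def isClassicalContradiction (φ : AForm) : Prop := ∀ v, φ.eval v = false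

/-- An agenda of ALL formulas, closed under complement, with no classical tautologies
or contradictions under the classical reading. -/
def isAgenda (Φ : Finset AForm) : Prop :=
  (∀ φ ∈ Φ, φ.compl ∈ Φ) ∧
  ∀ φ ∈ Φ, ¬ isClassicalTautology φ ∧ ¬ isClassicalContradiction φ

/-- Every derivable sequent contains exactly two formula occurrences. -/
theorem ADeriv.card_eq {Γ Δ : Multiset AForm} (h : ADeriv Γ Δ) :
    Multiset.card Γ + Multiset.card Δ = 2 := by
  induction h <;> simp only [Multiset.card_cons, Multiset.card_add, Multiset.card_singleton] at * <;>
    omega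

/-- Classical soundness of the calculus. -/
theorem ADeriv.sound {Γ Δ : Multiset AForm} (h : ADeriv Γ Δ) (v : ℕ → Bool) :
    (∃ φ ∈ Γ, φ.eval v = false) ∨ ∃ φ ∈ Δ, φ.eval v = true := by
  induction h with
  | ax A => cases hA : A.eval v <;> simp [hA]
  | cut _ _ ih1 ih2 =>
    simp only [Multiset.mem_cons, Multiset.mem_add, exists_eq_or_imp, or_and_right, exists_or] at *
    grind
  | _ =>
    simp only [Multiset.mem_cons, exists_eq_or_imp, AForm.eval, Bool.not_eq_true',
      Bool.not_eq_false', Bool.and_eq_true, Bool.or_eq_true, Bool.and_eq_false_iff,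
      Bool.or_eq_false_iff] at *
    grind

/-- the pair (classical logic, ALL) is safe for the majority rule: for
every such agenda Φ, every odd n ≥ 3, and every profile of judgment sets over Φ that
are classically consistent under the classical reading and complete, the majority
outcome is robustly consistent in ALL. -/
theorem classical_to_all_safe
    (Φ : Finset AForm) (hΦ : isAgenda Φ)
    (n : ℕ) (hodd : Odd n) (h3 : 3 ≤ n)
    (J : Fin n → Finset AForm)
    (hJ : ∀ i, J i ⊆ Φ ∧ classicallyConsistent (J i) ∧ completeOn Φ (J i)) :
    robustlyConsistent (maj n Φ J).val := by
  intro Δ hΔ hinc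
  have hcard : Multiset.card Δ = 2 := by simpa using ADeriv.card_eq hinc
  obtain ⟨φ, ψ, rfl⟩ := Multiset.card_eq_two.mp hcard
  have hφ : φ ∈ maj n Φ J := Multiset.mem_of_le hΔ (by simp)
  have hψ : ψ ∈ maj n Φ J := Multiset.mem_of_le hΔ (by simp)
  have h1 := (Finset.mem_filter.mp hφ).2
  have h2 := (Finset.mem_filter.mp hψ).2
  unfold nsupp at h1 h2
  -- two majorities intersect
  have hne : ((Finset.univ.filter (fun i => φ ∈ J i)) ∩
      (Finset.univ.filter (fun i => ψ ∈ J i))).Nonempty := by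
    have h4 := Finset.card_union_add_card_inter (Finset.univ.filter (fun i => φ ∈ J i))
      (Finset.univ.filter (fun i => ψ ∈ J i))
    have h5 := Finset.card_le_univ ((Finset.univ.filter (fun i => φ ∈ J i)) ∪
      (Finset.univ.filter (fun i => ψ ∈ J i)))
    rw [Fintype.card_fin] at h5
    apply Finset.card_pos.mp
    omega
  obtain ⟨i, hi⟩ := hne
  simp only [Finset.mem_inter, Finset.mem_filter, Finset.mem_univ, true_and] at hi
  obtain ⟨v, hv⟩ := (hJ i).2.1
  have e1 := hv φ hi.1
  have e2 := hv ψ hi.2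
  have := ADeriv.sound hinc v
  simp [e1, e2] at this

end Stmt19
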